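/- Assume (A1) and α = 1. For every c* > 0 and every k ∈ ℕ there exists a constant C ≥ 0, depending only on n, f, g, c* and k (in particular independent of ε), such that for every ε ∈ (0,1) and every positive classical solution u of the scaled problem on ℝ × [0,∞) whose derivatives u_t and u_x extend continuously to t = 0 and which satisfies u(x,t) ≥ ε c* for all (x,t) ∈ ℝ × [0,∞), one has |ε u_t(x,t)| + |u_x(x,t)| ≤ C for all (x,t) ∈ ℝ × [0, k ε² c*²/(n−1)). -/

import Mathlib

open Real Set Filter Topology

noncomputable section

/-- Partial derivative in the space variable `x`. -/
def pdx (u : ℝ → ℝ → ℝ) (x t : ℝ) : ℝ := deriv (fun y => u y t) x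

/-- Second partial derivative in the space variable `x`. -/
def pdxx (u : ℝ → ℝ → ℝ) (x t : ℝ) : ℝ := deriv (fun y => pdx u y t) x

/-- Partial derivative in the time variable `t`. -/
def pdt (u : ℝ → ℝ → ℝ) (x t : ℝ) : ℝ := deriv (fun s => u x s) t

/-- Assumption (A1): `f` is `C¹`, `ℤ`-periodic and positive; `g` is `C²`, `ℤ`-periodic
and positive. -/
def A1 (f g : ℝ → ℝ) : Prop :=
  ContDiff ℝ 1 f ∧ (∀ x, f (x + 1) = f x) ∧ (∀ x, 0 < f x) ∧
  ContDiff ℝ 2 g ∧ (∀ x, g (x + 1) = g x) ∧ (∀ x, 0 < g x)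

/-- A positive classical solution of the scaled problem on `ℝ × [0, T)`, where
`T : EReal` with `0 < T ≤ ∞`:
`u_t = u_xx/((u_x)² + 1) − (n−1)/u + (1/ε) f(x) √((u_x)² + 1)`, `u(x,0) = ε^α g(x)`. -/
structure IsSol (n : ℕ) (f g : ℝ → ℝ) (ε α : ℝ) (T : EReal) (u : ℝ → ℝ → ℝ) : Prop where
  pos : ∀ x t : ℝ, 0 ≤ t → (t : EReal) < T → 0 < u x t
  cont : ContinuousOn (fun p : ℝ × ℝ => u p.1 p.2)
    {p : ℝ × ℝ | 0 ≤ p.2 ∧ (p.2 : EReal) < T}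
  smooth : ContDiffOn ℝ (⊤ : ℕ∞) (fun p : ℝ × ℝ => u p.1 p.2)
    {p : ℝ × ℝ | 0 < p.2 ∧ (p.2 : EReal) < T}
  periodic : ∀ x t : ℝ, u (x + 1) t = u x t
  eqn : ∀ x t : ℝ, 0 < t → (t : EReal) < T →
    pdt u x t = pdxx u x t / ((pdx u x t) ^ 2 + 1) - ((n : ℝ) - 1) / u x t
      + (1 / ε) * f x * Real.sqrt ((pdx u x t) ^ 2 + 1)
  init : ∀ x : ℝ, u x 0 = ε ^ α * g x

theorem Function.Periodic.exists_forall_le_of_continuous {φ : ℝ → ℝ}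
    (hp : Function.Periodic φ 1) (hc : Continuous φ) : ∃ x₀, ∀ x, φ x ≤ φ x₀ := by
  obtain ⟨x₀, -, h⟩ := isCompact_Icc.exists_isMaxOn (nonempty_Icc.2 zero_le_one)
    (hc.continuousOn (s := Icc (0 : ℝ) 1))
  refine ⟨x₀, fun x => ?_⟩
  obtain ⟨y, hy, hxy⟩ := hp.exists_mem_Ico₀ one_pos x
  rw [hxy]
  exact h (Ico_subset_Icc_self hy)

theorem Function.Periodic.deriv_real {φ : ℝ → ℝ} {c : ℝ} (hp : Function.Periodic φ c) :
    Function.Periodic (deriv φ) c := by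
  intro x
  rw [← deriv_comp_add_const, funext hp]

/-- Necessary second-order condition at a maximum. -/
theorem deriv_deriv_nonpos_of_forall_le {φ : ℝ → ℝ} {x : ℝ} (hd : Continuous φ)
    (hmax : ∀ y, φ y ≤ φ x) : deriv (deriv φ) x ≤ 0 := by
  by_contra! hpos
  have hlm : IsLocalMax φ x := Eventually.of_forall hmax
  have hmin := isLocalMin_of_deriv_deriv_pos hpos hlm.deriv_eq_zero hd.continuousAt
  have hconst : φ =ᶠ[𝓝 x] fun _ => φ x := by
    filter_upwards [hmin] with y hy using le_antisymm (hmax y) hy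
  have h2 := hconst.deriv.deriv_eq
  simp at h2
  exact hpos.ne' h2

/-- First- and second-order conditions at a maximum of a difference. -/
theorem deriv_conditions_of_forall_sub_le {a b : ℝ → ℝ} {x : ℝ} (ha : ContDiff ℝ 2 a)
    (hb : ContDiff ℝ 2 b) (hmax : ∀ y, a y - b y ≤ a x - b x) :
    deriv a x = deriv b x ∧ deriv (deriv a) x ≤ deriv (deriv b) x := by
  have ha1 : Differentiable ℝ a := ha.differentiable (by norm_num)
  have hb1 : Differentiable ℝ b := hb.differentiable (by norm_num)
  have ha2 : Differentiable ℝ (deriv a) :=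
    (contDiff_succ_iff_deriv (n := 1).1 ha).2.2.differentiable (by norm_num)
  have hb2 : Differentiable ℝ (deriv b) :=
    (contDiff_succ_iff_deriv (n := 1).1 hb).2.2.differentiable (by norm_num)
  have hd : deriv (fun y => a y - b y) = fun y => deriv a y - deriv b y :=
    funext fun y => deriv_fun_sub (ha1 y) (hb1 y)
  constructor
  · have h : IsLocalMax (fun y => a y - b y) x := Eventually.of_forall hmax
    have := h.deriv_eq_zero
    rw [hd] at this
    linarith
  · have := deriv_deriv_nonpos_of_forall_le (ha.sub hb).continuous hmax
    rw [hd, deriv_fun_sub (ha2 x) (hb2 x)] at this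
    linarith

/-- A spatially periodic function that satisfies `D_t ≤ K D` at its positive spatial maxima grows
at most like `exp (K t)`. -/
theorem le_mul_exp_of_spatial_max {D D' : ℝ → ℝ → ℝ} {K M : ℝ} (hM : 0 ≤ M)
    (hc : ContinuousOn (fun p : ℝ × ℝ => D p.1 p.2) {p | 0 ≤ p.2})
    (hp : ∀ x t, D (x + 1) t = D x t)
    (hD : ∀ x t, 0 < t → HasDerivAt (D x) (D' x t) t)
    (hmax : ∀ x t, 0 < t → (∀ y, D y t ≤ D x t) → 0 < D x t → D' x t ≤ K * D x t)
    (h0 : ∀ x, D x 0 ≤ M) {x t : ℝ} (ht : 0 ≤ t) : D x t ≤ M * exp (K * t) := by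
  suffices h : ∀ δ > 0, D x t * exp (-(K * t)) - δ * t ≤ M by
    have h1 : D x t * exp (-(K * t)) ≤ M := by
      have hl : Tendsto (fun δ : ℝ => D x t * exp (-(K * t)) - δ * t) (𝓝[>] 0)
          (𝓝 (D x t * exp (-(K * t)) - 0 * t)) :=
        (Continuous.tendsto (by fun_prop) 0).mono_left nhdsWithin_le_nhds
      simpa using le_of_tendsto hl (eventually_mem_nhdsWithin.mono h)
    rwa [exp_neg, ← div_eq_mul_inv, div_le_iff₀ (exp_pos _)] at h1
  intro δ hδ
  by_contra! hlt
  set E : ℝ → ℝ → ℝ := fun x t => D x t * exp (-(K * t)) - δ * t with hE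
  have hEp : ∀ s, Function.Periodic (fun y => E y s) 1 := fun s y => by simp only [hE, hp]
  have hEc : ContinuousOn (fun p : ℝ × ℝ => E p.1 p.2) (Icc 0 1 ×ˢ Icc 0 t) :=
    ((hc.mono fun p hp => hp.2.1).mul (by fun_prop)).sub (by fun_prop)
  obtain ⟨⟨x₀, t₀⟩, hmem, hEmax⟩ := (isCompact_Icc.prod isCompact_Icc).exists_isMaxOn
    ⟨((0 : ℝ), t), ⟨by simp, by simp [ht]⟩⟩ hEc
  have hE' : ∀ y, ∀ s ∈ Icc 0 t, E y s ≤ E x₀ t₀ := by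
    intro y s hs
    obtain ⟨z, hz, hyz⟩ := (hEp s).exists_mem_Ico₀ one_pos y
    rw [hyz]
    exact hEmax (show (z, s) ∈ Icc 0 1 ×ˢ Icc 0 t from ⟨Ico_subset_Icc_self hz, hs⟩)
  have hpos : M < E x₀ t₀ := hlt.trans_le (hE' x t ⟨ht, le_rfl⟩)
  have ht₀ : 0 < t₀ := by
    refine hmem.2.1.lt_of_ne fun h => ?_
    simp only at h
    subst h
    have := h0 x₀
    simp only [hE] at hpos
    simp at hpos
    linarith
  have hDmax : ∀ y, D y t₀ ≤ D x₀ t₀ := fun y => by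
    have := hE' y t₀ hmem.2
    simp only [hE, sub_le_sub_iff_right] at this
    exact le_of_mul_le_mul_right this (exp_pos _)
  have hDpos : 0 < D x₀ t₀ := by
    have h1 : 0 < D x₀ t₀ * exp (-(K * t₀)) := by
      have : 0 < δ * t₀ := by positivity
      simp only [hE] at hpos
      linarith
    exact pos_of_mul_pos_left h1 (exp_pos _).le
  have hder : HasDerivAt (E x₀)
      (exp (-(K * t₀)) * (D' x₀ t₀ - K * D x₀ t₀) - δ) t₀ := by
    have h1 : HasDerivAt (fun s : ℝ => exp (-(K * s))) (exp (-(K * t₀)) * -(K * 1)) t₀ :=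
      ((hasDerivAt_id t₀).const_mul K).neg.exp
    exact (((hD x₀ t₀ ht₀).mul h1).sub ((hasDerivAt_id t₀).const_mul δ)).congr_deriv (by ring)
  have hneg : exp (-(K * t₀)) * (D' x₀ t₀ - K * D x₀ t₀) - δ < 0 := by
    have := mul_nonpos_of_nonneg_of_nonpos (exp_pos (-(K * t₀))).le
      (sub_nonpos.2 (hmax x₀ t₀ ht₀ hDmax hDpos))
    linarith
  have hnonneg : 0 ≤ exp (-(K * t₀)) * (D' x₀ t₀ - K * D x₀ t₀) - δ := by
    refine ge_of_tendsto hder.tendsto_slope_zero_left ?_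
    have hnear : ∀ᶠ h : ℝ in 𝓝[<] 0, -t₀ < h :=
      mem_nhdsWithin_of_mem_nhds (Ioi_mem_nhds (by linarith))
    filter_upwards [hnear, eventually_mem_nhdsWithin] with h hh1 hh2
    have hh2' : h < 0 := hh2
    have := hE' x₀ (t₀ + h) ⟨by linarith, by linarith [hmem.2.2]⟩
    rw [smul_eq_mul]
    exact mul_nonneg_of_nonpos_of_nonpos (inv_nonpos.2 hh2'.le) (by linarith)
  linarith

namespace IsSol

variable {n : ℕ} {f g : ℝ → ℝ} {ε α c : ℝ} {u : ℝ → ℝ → ℝ}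

theorem continuousOn_Ici (h : IsSol n f g ε α ⊤ u) :
    ContinuousOn (fun p : ℝ × ℝ => u p.1 p.2) {p | 0 ≤ p.2} :=
  h.cont.mono fun _ hp => ⟨hp, EReal.coe_lt_top _⟩

theorem contDiffAt (h : IsSol n f g ε α ⊤ u) (x : ℝ) {t : ℝ} (ht : 0 < t) :
    ContDiffAt ℝ (⊤ : ℕ∞) (fun p : ℝ × ℝ => u p.1 p.2) (x, t) := by
  refine h.smooth.contDiffAt ?_
  have : {p : ℝ × ℝ | 0 < p.2} ∈ 𝓝 (x, t) :=
    (isOpen_lt continuous_const continuous_snd).mem_nhds ht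
  filter_upwards [this] with p hp using ⟨hp, EReal.coe_lt_top _⟩

theorem contDiff_space (h : IsSol n f g ε α ⊤ u) {t : ℝ} (ht : 0 < t) :
    ContDiff ℝ 2 (fun y => u y t) := by
  rw [contDiff_iff_contDiffAt]
  intro x
  have h1 : ContDiffAt ℝ (⊤ : ℕ∞) (fun y : ℝ => (y, t)) x :=
    contDiffAt_id.prodMk contDiffAt_const
  have h2 : (2 : WithTop ℕ∞) ≤ ((⊤ : ℕ∞) : WithTop ℕ∞) :=
    WithTop.coe_le_coe.2 (le_top (a := (2 : ℕ∞)))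
  exact ((h.contDiffAt x ht).comp x h1).of_le h2

theorem hasDerivAt_time (h : IsSol n f g ε α ⊤ u) (x : ℝ) {t : ℝ} (ht : 0 < t) :
    HasDerivAt (u x) (pdt u x t) t := by
  have h1 : ContDiffAt ℝ (⊤ : ℕ∞) (fun s : ℝ => (x, s)) t :=
    contDiffAt_const.prodMk contDiffAt_id
  exact (((h.contDiffAt x ht).comp t h1).differentiableAt (by simp)).hasDerivAt

/-- Time shifts of a solution bounded below separate at most exponentially. -/
theorem sub_shift_le (h : IsSol n f g ε α ⊤ u) (hn : 1 ≤ n) (hc : 0 < c)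
    (hu : ∀ x t, 0 ≤ t → c ≤ u x t) {a b M : ℝ} (ha : 0 ≤ a) (hb : 0 ≤ b) (hM : 0 ≤ M)
    (h0 : ∀ x, u x a - u x b ≤ M) (x : ℝ) {t : ℝ} (ht : 0 ≤ t) :
    u x (t + a) - u x (t + b) ≤ M * exp (((n : ℝ) - 1) / c ^ 2 * t) := by
  have hn' : (0 : ℝ) ≤ n - 1 := by
    have : (1 : ℝ) ≤ n := by exact_mod_cast hn
    linarith
  have hshift : ∀ {s : ℝ}, 0 ≤ s →
      ContinuousOn (fun p : ℝ × ℝ => u p.1 (p.2 + s)) {p | 0 ≤ p.2} := fun {s} hs =>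
    h.continuousOn_Ici.comp (g := fun p : ℝ × ℝ => u p.1 p.2)
      (f := fun p : ℝ × ℝ => (p.1, p.2 + s)) (by fun_prop) fun p hp => add_nonneg hp hs
  refine le_mul_exp_of_spatial_max (D := fun x t => u x (t + a) - u x (t + b))
    (D' := fun x t => pdt u x (t + a) - pdt u x (t + b)) hM ((hshift ha).sub (hshift hb))
    (fun x t => by simp only [h.periodic]) ?_ ?_ (by simpa using h0) ht
  · intro x t ht
    exact ((h.hasDerivAt_time x (by linarith : 0 < t + a)).comp_add_const t a).sub
      ((h.hasDerivAt_time x (by linarith : 0 < t + b)).comp_add_const t b)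
  · intro x t ht hmax hpos
    have hta : 0 < t + a := by linarith
    have htb : 0 < t + b := by linarith
    obtain ⟨h1, h2⟩ := deriv_conditions_of_forall_sub_le (h.contDiff_space hta)
      (h.contDiff_space htb) hmax
    have h1' : pdx u x (t + a) = pdx u x (t + b) := h1
    have h2' : pdxx u x (t + a) ≤ pdxx u x (t + b) := h2
    rw [h.eqn x _ hta (EReal.coe_lt_top _), h.eqn x _ htb (EReal.coe_lt_top _), h1']
    have h3 : pdxx u x (t + a) / (pdx u x (t + b) ^ 2 + 1)
        ≤ pdxx u x (t + b) / (pdx u x (t + b) ^ 2 + 1) := by gcongr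
    have hA := hu x (t + a) hta.le
    have hB := hu x (t + b) htb.le
    have hA0 := hc.trans_le hA
    have hB0 := hc.trans_le hB
    have h4 : ((n : ℝ) - 1) / u x (t + b) - ((n : ℝ) - 1) / u x (t + a)
        = ((n : ℝ) - 1) / (u x (t + a) * u x (t + b)) * (u x (t + a) - u x (t + b)) := by
      field_simp
    have h5 : ((n : ℝ) - 1) / (u x (t + a) * u x (t + b)) ≤ ((n : ℝ) - 1) / c ^ 2 := by
      rw [pow_two]
      gcongr
    have h6 := mul_le_mul_of_nonneg_right h5 hpos.le
    linarith

/-- A solution stays above and below its initial datum `φ` shifted at the speeds allowed by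
the equation. -/
theorem abs_sub_init_le (h : IsSol n f g ε α ⊤ u) {φ : ℝ → ℝ} (hφ : ContDiff ℝ 2 φ)
    (hφp : ∀ x, φ (x + 1) = φ x) (hinit : ∀ x, u x 0 = φ x) {B : ℝ}
    (hB : ∀ x t, 0 < t → |deriv (deriv φ) x / (deriv φ x ^ 2 + 1) - ((n : ℝ) - 1) / u x t
      + (1 / ε) * f x * √(deriv φ x ^ 2 + 1)| ≤ B) (x : ℝ) {t : ℝ} (ht : 0 ≤ t) :
    |u x t - φ x| ≤ B * t := by
  have hφc : ContinuousOn (fun p : ℝ × ℝ => φ p.1) {p | 0 ≤ p.2} :=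
    (hφ.continuous.comp continuous_fst).continuousOn
  have hBt : ∀ t : ℝ, HasDerivAt (fun s => B * s) B t := fun t => by
    simpa using (hasDerivAt_id t).const_mul B
  have hupper : u x t - φ x - B * t ≤ 0 * exp (0 * t) := by
    refine le_mul_exp_of_spatial_max (D := fun x t => u x t - φ x - B * t)
      (D' := fun x t => pdt u x t - B) le_rfl
      ((h.continuousOn_Ici.sub hφc).sub (by fun_prop))
      (fun x t => by simp only [h.periodic, hφp]) ?_ ?_ (fun x => by simp [hinit]) ht
    · exact fun x t ht => ((h.hasDerivAt_time x ht).sub_const _).sub (hBt t)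
    · intro x t ht hmax _
      obtain ⟨h1, h2⟩ := deriv_conditions_of_forall_sub_le (h.contDiff_space ht) hφ
        (fun y => by have := hmax y; linarith)
      have h1' : pdx u x t = deriv φ x := h1
      have h2' : pdxx u x t ≤ deriv (deriv φ) x := h2
      have h3 : pdxx u x t / (deriv φ x ^ 2 + 1)
        ≤ deriv (deriv φ) x / (deriv φ x ^ 2 + 1) := by gcongr
      have h4 := (abs_le.1 (hB x t ht)).2
      rw [h.eqn x t ht (EReal.coe_lt_top _), h1']
      linarith
  have hlower : φ x - u x t - B * t ≤ 0 * exp (0 * t) := by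
    refine le_mul_exp_of_spatial_max (D := fun x t => φ x - u x t - B * t)
      (D' := fun x t => -pdt u x t - B) le_rfl
      ((hφc.sub h.continuousOn_Ici).sub (by fun_prop))
      (fun x t => by simp only [h.periodic, hφp]) ?_ ?_ (fun x => by simp [hinit]) ht
    · exact fun x t ht => ((h.hasDerivAt_time x ht).const_sub _).sub (hBt t)
    · intro x t ht hmax _
      obtain ⟨h1, h2⟩ := deriv_conditions_of_forall_sub_le hφ (h.contDiff_space ht)
        (fun y => by have := hmax y; linarith)
      have h1' : deriv φ x = pdx u x t := h1
      have h2' : deriv (deriv φ) x ≤ pdxx u x t := h2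
      have h3 : deriv (deriv φ) x / (deriv φ x ^ 2 + 1)
        ≤ pdxx u x t / (deriv φ x ^ 2 + 1) := by gcongr
      have h4 := (abs_le.1 (hB x t ht)).1
      rw [h.eqn x t ht (EReal.coe_lt_top _), ← h1']
      linarith
  rw [abs_le]
  constructor <;> linarith

theorem abs_pdt_le (h : IsSol n f g ε α ⊤ u) (hn : 1 ≤ n) (hc : 0 < c)
    (hu : ∀ x t, 0 ≤ t → c ≤ u x t) {B : ℝ} (hB : 0 ≤ B)
    (h0 : ∀ x t, 0 ≤ t → |u x t - u x 0| ≤ B * t) (x : ℝ) {t : ℝ} (ht : 0 < t) :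
    |pdt u x t| ≤ B * exp (((n : ℝ) - 1) / c ^ 2 * t) := by
  refine le_of_tendsto (h.hasDerivAt_time x ht).tendsto_slope_zero_right.abs ?_
  filter_upwards [eventually_mem_nhdsWithin] with s hs
  have hs' : 0 < s := hs
  have hBs : 0 ≤ B * s := by positivity
  have h1 := h.sub_shift_le hn hc hu hs'.le le_rfl hBs
    (fun y => (abs_le.1 (h0 y s hs'.le)).2) x ht.le
  have h2 := h.sub_shift_le hn hc hu le_rfl hs'.le hBs
    (fun y => by linarith [(abs_le.1 (h0 y s hs'.le)).1]) x ht.le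
  rw [add_zero] at h1 h2
  rw [smul_eq_mul, abs_mul, abs_of_pos (inv_pos.2 hs'), inv_mul_le_iff₀ hs', abs_le]
  constructor <;> linarith

/-- A bound on `u_t` at a fixed time gives a bound on `u_x` at that time. -/
theorem abs_pdx_le (h : IsSol n f g ε α ⊤ u) {m A t : ℝ} (hε : 0 < ε) (hm : 0 < m)
    (hf : ∀ x, m ≤ f x) (ht : 0 < t)
    (hA : ∀ x, ε * (pdt u x t + ((n : ℝ) - 1) / u x t) ≤ A) (hA0 : 0 ≤ A) (x : ℝ) :
    |pdx u x t| ≤ A / m := by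
  have hd : ContDiff ℝ 1 (fun y => pdx u y t) :=
    (contDiff_succ_iff_deriv (n := 1).1 (h.contDiff_space ht)).2.2
  have hper : Function.Periodic (fun y => pdx u y t) 1 :=
    Function.Periodic.deriv_real fun y => h.periodic y t
  obtain ⟨x₀, hx₀⟩ := Function.Periodic.exists_forall_le_of_continuous
    (φ := fun y => pdx u y t ^ 2) (fun y => by simp only [hper y]) (hd.continuous.pow 2)
  refine (sq_le_sq.1 (hx₀ x)).trans ?_
  have hder : HasDerivAt (fun y => pdx u y t) (pdxx u x₀ t) x₀ :=
    (hd.differentiable (by norm_num) x₀).hasDerivAt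
  have hlm : IsLocalMax (fun y => pdx u y t ^ 2) x₀ := Eventually.of_forall hx₀
  have hz := hlm.hasDerivAt_eq_zero (hder.pow 2)
  rcases eq_or_ne (pdx u x₀ t) 0 with h0 | h0
  · rw [h0, abs_zero]
    positivity
  have hxx : pdxx u x₀ t = 0 := by simpa [h0] using hz
  have heq := h.eqn x₀ t ht (EReal.coe_lt_top _)
  rw [hxx, zero_div, zero_sub] at heq
  have h1 : f x₀ * √(pdx u x₀ t ^ 2 + 1) ≤ A := by
    refine le_of_eq_of_le ?_ (hA x₀)
    rw [heq]
    field_simp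
    ring
  have h2 : |pdx u x₀ t| ≤ √(pdx u x₀ t ^ 2 + 1) := by
    rw [← sqrt_sq_eq_abs]
    exact sqrt_le_sqrt (by linarith)
  rw [le_div_iff₀ hm]
  have h3 := mul_le_mul (hf x₀) h2 (abs_nonneg _) (hm.le.trans (hf x₀))
  linarith

end IsSol

/-- Under (A1) with `α = 1`: for every `c* > 0` and `k ∈ ℕ` there is a
constant `C ≥ 0`, independent of `ε`, such that for every `ε ∈ (0,1)` and every positive
classical solution `u` of the scaled problem on `ℝ × [0,∞)` whose derivatives `u_t`, `u_x`
extend continuously to `t = 0` and which satisfies `u(x,t) ≥ ε c*` everywhere, one has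
`|ε u_t| + |u_x| ≤ C` on `ℝ × [0, k ε² c*²/(n−1))`. -/
theorem apriori_derivative_bound (n : ℕ) (hn : 2 ≤ n) (f g : ℝ → ℝ) (hA1 : A1 f g) :
    ∀ cs : ℝ, 0 < cs → ∀ k : ℕ, ∃ C : ℝ, 0 ≤ C ∧
      ∀ ε : ℝ, 0 < ε → ε < 1 → ∀ u : ℝ → ℝ → ℝ,
        IsSol n f g ε 1 ⊤ u →
        ContinuousOn (fun p : ℝ × ℝ => pdt u p.1 p.2) {p : ℝ × ℝ | 0 ≤ p.2} →
        ContinuousOn (fun p : ℝ × ℝ => pdx u p.1 p.2) {p : ℝ × ℝ | 0 ≤ p.2} →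
        (∀ x t : ℝ, 0 ≤ t → ε * cs ≤ u x t) →
        ∀ x t : ℝ, 0 ≤ t → t < (k : ℝ) * ε ^ 2 * cs ^ 2 / ((n : ℝ) - 1) →
          |ε * pdt u x t| + |pdx u x t| ≤ C := by
  intro cs hcs k
  obtain ⟨hf, hfp, hfpos, hg, hgp, -⟩ := hA1
  have hn1 : (1 : ℝ) ≤ n := by exact_mod_cast (by omega : 1 ≤ n)
  have hn0 : (0 : ℝ) < n - 1 := by
    have : (2 : ℝ) ≤ n := by exact_mod_cast hn
    linarith
  have hg1 : ContDiff ℝ 1 (deriv g) := (contDiff_succ_iff_deriv (n := 1).1 hg).2.2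
  have hg2 : Continuous (deriv (deriv g)) := hg1.continuous_deriv le_rfl
  have hgp1 : Function.Periodic (deriv g) 1 := Function.Periodic.deriv_real hgp
  obtain ⟨xF, hF⟩ := Function.Periodic.exists_forall_le_of_continuous hfp hf.continuous
  obtain ⟨xm, hm⟩ := Function.Periodic.exists_forall_le_of_continuous (φ := fun x => -f x)
    (fun x => by simp only [hfp]) hf.continuous.neg
  obtain ⟨x1, hG1⟩ := Function.Periodic.exists_forall_le_of_continuous
    (φ := fun x => deriv g x ^ 2) (fun x => by simp only [hgp1 x]) (hg1.continuous.pow 2)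
  obtain ⟨x2, hG2⟩ := Function.Periodic.exists_forall_le_of_continuous
    (φ := fun x => |deriv (deriv g) x|) (fun x => by simp only [hgp1.deriv_real x]) hg2.abs
  set B := |deriv (deriv g) x2| + ((n : ℝ) - 1) / cs + f xF * √(deriv g x1 ^ 2 + 1) with hBdef
  have hFpos := hfpos xF
  have hB : 0 ≤ B := by positivity
  set C₁ := B * exp k with hC₁
  set C₂ := (C₁ + ((n : ℝ) - 1) / cs) / f xm with hC₂
  have hC₁0 : 0 ≤ C₁ := by positivity
  have hC₂0 : 0 ≤ C₂ := div_nonneg (by positivity) (hfpos xm).le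
  refine ⟨C₁ + C₂, by positivity, ?_⟩
  intro ε hε hε1 u hu hct hcx hlow
  have hεcs : 0 < ε * cs := by positivity
  have hinv : ∀ x t, 0 ≤ t → ε * (((n : ℝ) - 1) / u x t) ≤ ((n : ℝ) - 1) / cs := by
    intro x t ht
    calc ε * (((n : ℝ) - 1) / u x t) ≤ ε * (((n : ℝ) - 1) / (ε * cs)) := by
          gcongr
          exact hlow x t ht
      _ = ((n : ℝ) - 1) / cs := by field_simp
  have hinit : ∀ x, u x 0 = ε * g x := fun x => by rw [hu.init, rpow_one]
  have hd1 : deriv (fun x => ε * g x) = fun x => ε * deriv g x :=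
    funext fun x => deriv_const_mul_field ε
  have hd2 : deriv (deriv fun x => ε * g x) = fun x => ε * deriv (deriv g) x := by
    rw [hd1]
    exact funext fun x => deriv_const_mul_field ε
  have hstart : ∀ x t, 0 ≤ t → |u x t - u x 0| ≤ B / ε * t := by
    intro x t ht
    rw [hinit]
    refine hu.abs_sub_init_le (φ := fun x => ε * g x) (contDiff_const.mul hg)
      (fun x => by simp only [hgp]) hinit ?_ x ht
    intro x t ht
    rw [hd2, hd1]
    simp only
    have hsplit : ε * deriv (deriv g) x / ((ε * deriv g x) ^ 2 + 1) - ((n : ℝ) - 1) / u x t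
        + 1 / ε * f x * √((ε * deriv g x) ^ 2 + 1)
        = (ε * ε * deriv (deriv g) x / ((ε * deriv g x) ^ 2 + 1)
          - ε * (((n : ℝ) - 1) / u x t) + f x * √((ε * deriv g x) ^ 2 + 1)) / ε := by
      field_simp
    rw [hsplit, abs_div, abs_of_pos hε]
    refine div_le_div_of_nonneg_right ?_ hε.le
    have e1 : |ε * ε * deriv (deriv g) x / ((ε * deriv g x) ^ 2 + 1)|
        ≤ |deriv (deriv g) x2| := by
      have h1 : (1 : ℝ) ≤ (ε * deriv g x) ^ 2 + 1 := by linarith [sq_nonneg (ε * deriv g x)]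
      rw [abs_div, abs_of_pos (by linarith : (0 : ℝ) < (ε * deriv g x) ^ 2 + 1), abs_mul,
        abs_of_pos (by positivity : 0 < ε * ε)]
      refine (div_le_self (by positivity) h1).trans (le_trans ?_ (hG2 x))
      exact mul_le_of_le_one_left (abs_nonneg _) (by nlinarith)
    have e2 : |ε * (((n : ℝ) - 1) / u x t)| ≤ ((n : ℝ) - 1) / cs := by
      have := hεcs.trans_le (hlow x t ht.le)
      rw [abs_of_nonneg (by positivity)]
      exact hinv x t ht.le
    have e3 : |f x * √((ε * deriv g x) ^ 2 + 1)| ≤ f xF * √(deriv g x1 ^ 2 + 1) := by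
      have := hfpos x
      rw [abs_of_nonneg (by positivity)]
      have h1 : (ε * deriv g x) ^ 2 ≤ deriv g x1 ^ 2 := by
        rw [mul_pow]
        exact (mul_le_of_le_one_left (sq_nonneg _) (by nlinarith)).trans (hG1 x)
      gcongr
      exact hF x
    refine (abs_add_le _ _).trans (add_le_add ((abs_sub _ _).trans (add_le_add e1 e2)) e3)
  have hinterior : ∀ x t, 0 < t → t < (k : ℝ) * ε ^ 2 * cs ^ 2 / ((n : ℝ) - 1) →
      |ε * pdt u x t| + |pdx u x t| ≤ C₁ + C₂ := by
    intro x t ht htk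
    have hpdt : ∀ y, |ε * pdt u y t| ≤ C₁ := by
      intro y
      have h1 := hu.abs_pdt_le (by omega) hεcs hlow (by positivity) hstart y ht
      have h2 : ((n : ℝ) - 1) / (ε * cs) ^ 2 * t ≤ k := by
        rw [lt_div_iff₀ hn0] at htk
        rw [div_mul_eq_mul_div, div_le_iff₀ (by positivity)]
        linarith
      rw [abs_mul, abs_of_pos hε]
      calc ε * |pdt u y t| ≤ ε * (B / ε * exp k) := by
            gcongr
            exact h1.trans (by gcongr)
        _ = C₁ := by rw [hC₁]; field_simp
    refine add_le_add (hpdt x) (hu.abs_pdx_le hε (hfpos xm) (fun y => ?_) ht (fun y => ?_)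
      (by positivity) x)
    · exact neg_le_neg_iff.1 (hm y)
    · rw [mul_add]
      exact add_le_add ((le_abs_self _).trans (hpdt y)) (hinv y t ht.le)
  intro x t ht htk
  rcases ht.eq_or_lt with rfl | ht
  · have hc : ContinuousOn (fun s => |ε * pdt u x s| + |pdx u x s|) (Ici 0) := by
      have hpair : ContinuousOn (fun s : ℝ => (x, s)) (Ici 0) := by fun_prop
      exact ((continuousOn_const.mul (hct.comp hpair fun s hs => hs)).abs).add
        (hcx.comp hpair fun s hs => hs).abs
    have hl := ((hc 0 self_mem_Ici).mono Ioi_subset_Ici_self).tendsto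
    refine le_of_tendsto hl ?_
    have hnear : ∀ᶠ s : ℝ in 𝓝[>] 0, s < (k : ℝ) * ε ^ 2 * cs ^ 2 / ((n : ℝ) - 1) :=
      mem_nhdsWithin_of_mem_nhds (Iio_mem_nhds htk)
    filter_upwards [hnear, eventually_mem_nhdsWithin] with s hs1 hs2 using hinterior x s hs2 hs1
  · exact hinterior x t ht htk
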